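/- Fix φ∈[0,2π]. For every f∈W, the function s↦J_α f(φ,s), initially defined for real s, extends to a holomorphic function on the whole complex plane ℂ. -/

import Mathlib

open MeasureTheory Metric Set
open scoped Real

noncomputable section

/-- The open unit disk in ℂ. -/
def Disk : Set ℂ := Metric.ball (0 : ℂ) 1

/-- The weight `(1-|z|²)^(α-2)`. -/
def wt (α : ℝ) (z : ℂ) : ℝ := (1 - ‖z‖ ^ 2) ^ (α - 2)

/-- The kernel `K_α(φ,s;z,u)`. -/
def Kker (α : ℝ) (φ : ℝ) (s : ℂ) (z u : ℂ) : ℂ :=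
  (1 - (starRingEnd ℂ z) * Complex.exp (Complex.I * φ)) ^ (-(1/2 : ℂ) - Complex.I * s) *
  (1 - u * Complex.exp (-(Complex.I * φ))) ^ (-(1/2 : ℂ) - Complex.I * s) *
  (1 - (starRingEnd ℂ z) * u) ^ (-((α : ℂ) - 1/2 - Complex.I * s))

/-- The operator `J_α`; the second argument of `f` represents `ū`. -/
def Jop (α : ℝ) (f : ℂ → ℂ → ℂ) (φ : ℝ) (s : ℂ) : ℂ :=
  ∫ p in Disk ×ˢ Disk,
    Kker α φ s p.1 p.2 * f p.1 (starRingEnd ℂ p.2) * (wt α p.1 : ℂ) * (wt α p.2 : ℂ)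

/-- Membership in `H_α ⊗ H̄_α` (functions of `(z, ū)`). -/
def MemHT (α : ℝ) (f : ℂ → ℂ → ℂ) : Prop :=
  DifferentiableOn ℂ (fun p : ℂ × ℂ => f p.1 p.2) (Disk ×ˢ Disk) ∧
  IntegrableOn (fun p : ℂ × ℂ => ‖f p.1 p.2‖ ^ 2 * wt α p.1 * wt α p.2) (Disk ×ˢ Disk)

/-- Membership in `W`: analytic continuation to a larger bidisk. -/
def MemW (α : ℝ) (f : ℂ → ℂ → ℂ) : Prop :=
  MemHT α f ∧ ∃ δ > (0:ℝ), ∃ g : ℂ → ℂ → ℂ,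
    DifferentiableOn ℂ (fun p : ℂ × ℂ => g p.1 p.2)
      (Metric.ball (0:ℂ) (1+δ) ×ˢ Metric.ball (0:ℂ) (1+δ)) ∧
    ∀ p ∈ Disk ×ˢ Disk, g p.1 p.2 = f p.1 p.2

/-- The operator `M₀ = z ∂/∂z + ū ∂/∂ū + α`. -/
def Mzero (α : ℝ) (f : ℂ → ℂ → ℂ) : ℂ → ℂ → ℂ :=
  fun z w => z * deriv (fun ζ => f ζ w) z + w * deriv (fun ω => f z ω) w + (α : ℂ) * f z w

/-- Inner product on `H_α ⊗ H̄_α`. -/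
def innerHT (α : ℝ) (f g : ℂ → ℂ → ℂ) : ℂ :=
  (((α - 1) ^ 2 / π ^ 2 : ℝ) : ℂ) *
    ∫ p in Disk ×ˢ Disk,
      f p.1 p.2 * starRingEnd ℂ (g p.1 p.2) * (wt α p.1 : ℂ) * (wt α p.2 : ℂ)

lemma lintegral_abs_rpow_lt_top {b : ℝ} (hb : b < 1) :
    ∫⁻ θ in Ioo (-π) π, ENNReal.ofReal (|θ| ^ (-b)) < ⊤ := by
  have hpos : IntegrableOn (fun θ : ℝ => |θ| ^ (-b)) (Ioc 0 π) := by
    have h := (intervalIntegral.intervalIntegrable_rpow' (r := -b) (a := 0) (b := π)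
      (by linarith)).1
    refine h.congr_fun (fun θ hθ => ?_) measurableSet_Ioc
    simp only [abs_of_pos hθ.1]
  have hneg : IntegrableOn (fun θ : ℝ => |θ| ^ (-b)) (Ico (-π) 0) := by
    have h := hpos.comp_neg
    simpa using h
  have hall : IntegrableOn (fun θ : ℝ => |θ| ^ (-b)) (Ioo (-π) π) := by
    refine ((hneg.union (integrableOn_singleton (x := (0 : ℝ)) (hx := by simp))).union hpos).mono_set ?_
    rintro θ ⟨h1, h2⟩
    rcases lt_trichotomy θ 0 with h | h | h
    · exact Or.inl (Or.inl ⟨h1.le, h⟩)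
    · exact Or.inl (Or.inr h)
    · exact Or.inr ⟨h, h2.le⟩
  exact hall.lintegral_lt_top

lemma lintegral_one_sub_rpow_lt_top {c : ℝ} (hc : -1 < c) :
    ∫⁻ r in Ioo (0 : ℝ) 1, ENNReal.ofReal ((1 - r) ^ c) < ⊤ := by
  have h := (intervalIntegral.intervalIntegrable_rpow' (r := c) (a := 0) (b := 1)
    hc).comp_sub_left 1
  have h2 : IntegrableOn (fun r : ℝ => (1 - r) ^ c) (Ioo 0 1) := by
    refine h.symm.1.mono_set ?_
    intro r hr
    simpa using ⟨hr.1, hr.2.le⟩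
  exact h2.lintegral_lt_top

lemma abs_div_pi_le_norm_one_sub {x θ : ℝ} (hx : 0 ≤ x) (hθ : |θ| < π) :
    |θ| / π ≤ ‖1 - (x : ℂ) * (Real.cos θ + Real.sin θ * Complex.I)‖ := by
  have hsq : ‖1 - (x : ℂ) * (Real.cos θ + Real.sin θ * Complex.I)‖ ^ 2
      = (1 - x * Real.cos θ) ^ 2 + (x * Real.sin θ) ^ 2 := by
    rw [← Complex.normSq_eq_norm_sq, Complex.normSq_apply]
    simp only [Complex.sub_re, Complex.one_re, Complex.sub_im, Complex.one_im, Complex.re_ofReal_mul,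
      Complex.im_ofReal_mul, Complex.add_re, Complex.add_im, Complex.ofReal_re, Complex.ofReal_im,
      Complex.I_re, Complex.I_im]
    ring
  have hcs := Real.sin_sq_add_cos_sq θ
  have hpi := Real.pi_pos
  refine le_of_sq_le_sq ?_ (norm_nonneg _)
  rw [hsq]
  rcases le_total |θ| (π / 2) with h | h
  · have h1 := Real.mul_abs_le_abs_sin h
    have h2 : |θ| / π ≤ |Real.sin θ| := by
      refine le_trans ?_ h1
      rw [div_mul_eq_mul_div]
      gcongr
      linarith [abs_nonneg θ]
    have h3 : (|θ| / π) ^ 2 ≤ Real.sin θ ^ 2 := by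
      rw [← sq_abs (Real.sin θ)]
      gcongr
    nlinarith [sq_nonneg (x - Real.cos θ)]
  · have hcos : Real.cos θ ≤ 0 := by
      rw [← Real.cos_abs]
      exact Real.cos_nonpos_of_pi_div_two_le_of_le h (by linarith)
    have h1 : |θ| / π ≤ 1 := by rw [div_le_one hpi]; exact hθ.le
    have h2 : (|θ| / π) ^ 2 ≤ 1 := by
      have : 0 ≤ |θ| / π := by positivity
      nlinarith
    nlinarith [mul_nonneg hx (neg_nonneg.2 hcos), sq_nonneg (x * Real.cos θ),
      sq_nonneg (x * Real.sin θ)]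

lemma one_sub_sq_half_le_norm_one_sub {w : ℂ} {r : ℝ} (hr1 : r ≤ 1)
    (hw : ‖w‖ ≤ r) : (1 - r ^ 2) / 2 ≤ ‖1 - w‖ := by
  have h := norm_sub_norm_le (1 : ℂ) w
  rw [norm_one] at h
  nlinarith

/-- The pointwise estimate in polar coordinates behind the Forelli–Rudin bound. -/
lemma norm_one_sub_rpow_mul_le {x r θ b₁ b₂ γ : ℝ} (hx : 0 ≤ x) (hx1 : x ≤ 1) (hr : 0 < r)
    (hr1 : r < 1) (hθ : |θ| < π) (hθ0 : θ ≠ 0) (hb₁ : 0 ≤ b₁) (hb₂ : 0 ≤ b₂) :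
    r * (‖1 - (x : ℂ) * (r * (Real.cos θ + Real.sin θ * Complex.I))‖ ^ (-(b₁ + b₂)) *
      (1 - r ^ 2) ^ γ) ≤
      (2 ^ b₁ * π ^ b₂ * 2 ^ |γ - b₁|) * ((1 - r) ^ (γ - b₁) * |θ| ^ (-b₂)) := by
  set N := ‖1 - (x : ℂ) * (r * (Real.cos θ + Real.sin θ * Complex.I))‖ with hN
  have hpi := Real.pi_pos
  have hA : 0 < |θ| := abs_pos.2 hθ0
  have hr2 : 0 < 1 - r ^ 2 := by nlinarith
  have h1 : |θ| / π ≤ N := by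
    have := abs_div_pi_le_norm_one_sub (x := x * r) (θ := θ) (by positivity) hθ
    rw [hN]
    convert this using 3
    push_cast
    ring
  have h2 : (1 - r ^ 2) / 2 ≤ N := by
    refine one_sub_sq_half_le_norm_one_sub hr1.le ?_
    rw [norm_mul, norm_mul, Complex.norm_real, Complex.norm_real, Complex.ofReal_cos,
      Complex.ofReal_sin, Complex.norm_cos_add_sin_mul_I,
      Real.norm_of_nonneg hx, Real.norm_of_nonneg hr.le]
    nlinarith
  have hNpos : 0 < N := lt_of_lt_of_le (by positivity) h1
  have e1 : N ^ (-b₁) ≤ 2 ^ b₁ * (1 - r ^ 2) ^ (-b₁) := by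
    calc N ^ (-b₁) ≤ ((1 - r ^ 2) / 2) ^ (-b₁) :=
          Real.rpow_le_rpow_of_nonpos (by positivity) h2 (by linarith)
      _ = 2 ^ b₁ * (1 - r ^ 2) ^ (-b₁) := by
          rw [Real.div_rpow hr2.le (by norm_num), Real.rpow_neg (by norm_num : (0:ℝ) ≤ 2)]
          field_simp
  have e2 : N ^ (-b₂) ≤ π ^ b₂ * |θ| ^ (-b₂) := by
    calc N ^ (-b₂) ≤ (|θ| / π) ^ (-b₂) :=
          Real.rpow_le_rpow_of_nonpos (by positivity) h1 (by linarith)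
      _ = π ^ b₂ * |θ| ^ (-b₂) := by
          rw [Real.div_rpow hA.le hpi.le, Real.rpow_neg hpi.le]
          field_simp
  have e3 : (1 - r ^ 2) ^ (γ - b₁) ≤ 2 ^ |γ - b₁| * (1 - r) ^ (γ - b₁) := by
    have : 1 - r ^ 2 = (1 + r) * (1 - r) := by ring
    rw [this, Real.mul_rpow (by linarith) (by linarith)]
    gcongr
    calc (1 + r) ^ (γ - b₁) ≤ (1 + r) ^ |γ - b₁| :=
          Real.rpow_le_rpow_of_exponent_le (by linarith) (le_abs_self _)
      _ ≤ 2 ^ |γ - b₁| := Real.rpow_le_rpow (by linarith) (by linarith) (abs_nonneg _)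
  have hsplit : N ^ (-(b₁ + b₂)) = N ^ (-b₁) * N ^ (-b₂) := by
    rw [← Real.rpow_add hNpos]; ring_nf
  calc r * (N ^ (-(b₁ + b₂)) * (1 - r ^ 2) ^ γ)
      ≤ 1 * (N ^ (-(b₁ + b₂)) * (1 - r ^ 2) ^ γ) := by gcongr
    _ = N ^ (-b₁) * N ^ (-b₂) * (1 - r ^ 2) ^ γ := by rw [hsplit, one_mul]
    _ ≤ (2 ^ b₁ * (1 - r ^ 2) ^ (-b₁)) * (π ^ b₂ * |θ| ^ (-b₂)) * (1 - r ^ 2) ^ γ := by gcongr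
    _ = (2 ^ b₁ * π ^ b₂) * ((1 - r ^ 2) ^ (γ - b₁) * |θ| ^ (-b₂)) := by
        rw [sub_eq_add_neg γ, Real.rpow_add hr2]; ring
    _ ≤ (2 ^ b₁ * π ^ b₂) * ((2 ^ |γ - b₁| * (1 - r) ^ (γ - b₁)) * |θ| ^ (-b₂)) := by gcongr
    _ = _ := by ring

lemma exists_lintegral_ofReal_bound {b₁ b₂ γ : ℝ} (hb₁ : 0 ≤ b₁) (hb₂ : 0 ≤ b₂)
    (hγ : b₁ < γ + 1) (hb₂' : b₂ < 1) :
    ∃ M : ENNReal, M < ⊤ ∧ ∀ x : ℝ, 0 ≤ x → x ≤ 1 →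
      ∫⁻ u in Disk, ENNReal.ofReal (‖1 - (x : ℂ) * u‖ ^ (-(b₁ + b₂)) * (1 - ‖u‖ ^ 2) ^ γ) ≤ M := by
  set C : ℝ := 2 ^ b₁ * π ^ b₂ * 2 ^ |γ - b₁| with hC
  have hC0 : 0 ≤ C := by positivity
  set A : ℝ → ENNReal := (Ioo (0:ℝ) 1).indicator fun r => ENNReal.ofReal ((1 - r) ^ (γ - b₁))
    with hA
  have hAm : Measurable A := by
    refine Measurable.indicator ?_ measurableSet_Ioo
    fun_prop
  set B : ℝ → ENNReal := fun θ => ENNReal.ofReal (|θ| ^ (-b₂)) with hB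
  have hBm : Measurable B := by fun_prop
  refine ⟨ENNReal.ofReal C * ((∫⁻ r in Ioi 0, A r) * ∫⁻ θ in Ioo (-π) π, B θ), ?_, ?_⟩
  · refine ENNReal.mul_lt_top ENNReal.ofReal_lt_top (ENNReal.mul_lt_top ?_
      (lintegral_abs_rpow_lt_top hb₂'))
    refine lt_of_le_of_lt (setLIntegral_le_lintegral _ _) ?_
    rw [hA, lintegral_indicator measurableSet_Ioo]
    exact lintegral_one_sub_rpow_lt_top (by linarith)
  · intro x hx hx1
    rw [← lintegral_indicator (by exact measurableSet_ball),
      ← Complex.lintegral_comp_polarCoord_symm]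
    have hprod : (volume : Measure (ℝ × ℝ)).restrict polarCoord.target
        = (volume.restrict (Ioi 0)).prod (volume.restrict (Ioo (-π) π)) := by
      rw [polarCoord_target, Measure.prod_restrict]; rfl
    rw [← lintegral_prod_mul hAm.aemeasurable hBm.aemeasurable, ← hprod,
      ← lintegral_const_mul _ (by fun_prop)]
    have hne : ∀ᵐ p ∂(volume : Measure (ℝ × ℝ)).restrict polarCoord.target, p.2 ≠ 0 := by
      rw [hprod]
      exact Measure.quasiMeasurePreserving_snd.ae
        (ae_restrict_of_ae (Measure.ae_ne volume (0 : ℝ)))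
    refine lintegral_mono_ae ?_
    filter_upwards [hne, ae_restrict_mem polarCoord.open_target.measurableSet] with p hp0 hp
    obtain ⟨r, θ⟩ := p
    rw [polarCoord_target] at hp
    obtain ⟨hr, hθ⟩ := hp
    simp only [mem_Ioi, mem_Ioo] at hr hθ hp0
    by_cases hr1 : r < 1
    · have hmem : Complex.polarCoord.symm (r, θ) ∈ Disk := by
        simp [Disk, abs_of_pos hr, hr1]
      rw [indicator_of_mem hmem, Complex.norm_polarCoord_symm, Complex.polarCoord_symm_apply]
      simp only [hA, hB, indicator_of_mem (show r ∈ Ioo (0:ℝ) 1 from ⟨hr, hr1⟩), smul_eq_mul,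
        abs_of_pos hr]
      rw [← ENNReal.ofReal_mul hr.le, ← ENNReal.ofReal_mul (by
        have : 0 < 1 - r := by linarith
        positivity), ← ENNReal.ofReal_mul hC0]
      exact ENNReal.ofReal_le_ofReal (norm_one_sub_rpow_mul_le hx hx1 hr hr1
        (abs_lt.2 hθ) hp0 hb₁ hb₂)
    · have hmem : Complex.polarCoord.symm (r, θ) ∉ Disk := by
        simp [Disk, abs_of_pos hr]
        linarith
      rw [indicator_of_notMem hmem]
      simp

lemma measurePreserving_unit_mul {c : ℂ} (hc : ‖c‖ = 1) :
    MeasurePreserving (fun u : ℂ => c * u) := by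
  have := (rotation ⟨c, by simpa [Submonoid.unitSphere] using hc⟩).measurePreserving
  exact this

lemma measurableEmbedding_unit_mul {c : ℂ} (hc : ‖c‖ = 1) :
    MeasurableEmbedding (fun u : ℂ => c * u) :=
  measurableEmbedding_mulLeft₀ (by rintro rfl; simp at hc)

/-- A Forelli–Rudin type bound, uniform in `ζ` in the closed disk. -/
lemma exists_lintegral_norm_one_sub_rpow_bound {β γ : ℝ} (hγ : -1 < γ) (hβ : 0 ≤ β)
    (hβγ : β < γ + 2) :
    ∃ M : ENNReal, M < ⊤ ∧ ∀ ζ : ℂ, ‖ζ‖ ≤ 1 →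
      ∫⁻ u in Disk, ENNReal.ofReal (‖1 - ζ * u‖ ^ (-β) * (1 - ‖u‖ ^ 2) ^ γ) ≤ M := by
  have h2 : 0 < γ + 2 := by linarith
  have hq : β / (γ + 2) < 1 := by rwa [div_lt_one h2]
  obtain ⟨M, hM, h⟩ := exists_lintegral_ofReal_bound (b₁ := β / (γ + 2) * (γ + 1))
    (b₂ := β / (γ + 2)) (γ := γ) (mul_nonneg (by positivity) (by linarith)) (by positivity)
    (by nlinarith) hq
  have hsum : β / (γ + 2) * (γ + 1) + β / (γ + 2) = β := by field_simp; ring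
  rw [hsum] at h
  refine ⟨M, hM, fun ζ hζ => ?_⟩
  set c : ℂ := Complex.exp (Complex.arg ζ * Complex.I) with hc
  have hc1 : ‖c‖ = 1 := Complex.norm_exp_ofReal_mul_I _
  have hζc : ζ = ‖ζ‖ * c := (Complex.norm_mul_exp_arg_mul_I ζ).symm
  have hpre : (fun u : ℂ => c * u) ⁻¹' Disk = Disk := by
    ext u; simp [Disk, hc1]
  have key := (measurePreserving_unit_mul hc1).setLIntegral_comp_preimage_emb
    (measurableEmbedding_unit_mul hc1)
    (fun u => ENNReal.ofReal (‖1 - (‖ζ‖ : ℂ) * u‖ ^ (-β) * (1 - ‖u‖ ^ 2) ^ γ)) Disk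
  rw [hpre] at key
  refine le_trans (le_of_eq ?_) (h ‖ζ‖ (norm_nonneg _) hζ)
  rw [← key]
  refine lintegral_congr fun u => ?_
  rw [norm_mul c u, hc1, one_mul, ← mul_assoc, ← hζc]

lemma one_sub_norm_sq_pos {z : ℂ} (hz : z ∈ Disk) : 0 < 1 - ‖z‖ ^ 2 := by
  have h : ‖z‖ < 1 := by simpa [Disk] using hz
  nlinarith [norm_nonneg z]

lemma wt_pos (α : ℝ) {z : ℂ} (hz : z ∈ Disk) : 0 < wt α z :=
  Real.rpow_pos_of_pos (one_sub_norm_sq_pos hz) _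

lemma measurable_wt (α : ℝ) : Measurable (wt α) := by
  unfold wt
  fun_prop

lemma rpow_neg_mul_rpow_neg_le {x y a b : ℝ} (hx : 0 < x) (hy : 0 < y) (ha : 0 ≤ a)
    (hb : 0 ≤ b) : x ^ (-a) * y ^ (-b) ≤ x ^ (-(a + b)) + y ^ (-(a + b)) := by
  have hx' := Real.rpow_pos_of_pos hx (-(a + b))
  have hy' := Real.rpow_pos_of_pos hy (-(a + b))
  rcases le_total x y with h | h
  · have h1 : y ^ (-b) ≤ x ^ (-b) := Real.rpow_le_rpow_of_nonpos hx h (by linarith)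
    calc x ^ (-a) * y ^ (-b) ≤ x ^ (-a) * x ^ (-b) := by gcongr
      _ = x ^ (-(a + b)) := by rw [← Real.rpow_add hx]; ring_nf
      _ ≤ _ := by linarith
  · have h1 : x ^ (-a) ≤ y ^ (-a) := Real.rpow_le_rpow_of_nonpos hy h (by linarith)
    calc x ^ (-a) * y ^ (-b) ≤ y ^ (-a) * y ^ (-b) := by gcongr
      _ = y ^ (-(a + b)) := by rw [← Real.rpow_add hy]; ring_nf
      _ ≤ _ := by linarith

lemma norm_one_sub_pos {w : ℂ} (hw : ‖w‖ < 1) : 0 < ‖1 - w‖ := by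
  refine norm_pos_iff.2 fun h => ?_
  rw [← sub_eq_zero.1 h, norm_one] at hw
  exact lt_irrefl _ hw

/-- The modulus of the integrand of `Jop` for real `s`, up to bounded factors. -/
def majorant (α : ℝ) (a b : ℂ) (p : ℂ × ℂ) : ℝ :=
  ‖1 - starRingEnd ℂ p.1 * a‖ ^ (-(1 / 2) : ℝ) * ‖1 - p.2 * b‖ ^ (-(1 / 2) : ℝ) *
    ‖1 - starRingEnd ℂ p.1 * p.2‖ ^ (-(α - 1 / 2)) * wt α p.1 * wt α p.2

lemma majorant_le {α : ℝ} (hα : 1 < α) {a b z u : ℂ} (hb : ‖b‖ = 1)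
    (hz : z ∈ Disk) (hu : u ∈ Disk) :
    majorant α a b (z, u) ≤
      (2 ^ ((α - 1) / 2) *
        (‖1 - starRingEnd ℂ a * z‖ ^ (-(1 / 2) : ℝ) * (1 - ‖z‖ ^ 2) ^ ((α - 3) / 2))) *
      (‖1 - b * u‖ ^ (-((α + 1) / 2)) * (1 - ‖u‖ ^ 2) ^ (α - 2) +
        ‖1 - starRingEnd ℂ z * u‖ ^ (-((α + 1) / 2)) * (1 - ‖u‖ ^ 2) ^ (α - 2)) := by
  have hz1 : ‖z‖ < 1 := by simpa [Disk] using hz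
  have hu1 : ‖u‖ < 1 := by simpa [Disk] using hu
  have hwz := one_sub_norm_sq_pos hz
  have hwu := one_sub_norm_sq_pos hu
  have hA : ‖1 - starRingEnd ℂ z * a‖ = ‖1 - starRingEnd ℂ a * z‖ := by
    rw [← Complex.norm_conj]
    simp [mul_comm]
  have hzu : ‖starRingEnd ℂ z * u‖ ≤ ‖z‖ := by
    rw [norm_mul, Complex.norm_conj]
    nlinarith [norm_nonneg z]
  have hC := one_sub_sq_half_le_norm_one_sub hz1.le hzu
  have hCpos : 0 < ‖1 - starRingEnd ℂ z * u‖ := norm_one_sub_pos (hzu.trans_lt hz1)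
  have hBpos : 0 < ‖1 - b * u‖ := norm_one_sub_pos (by rwa [norm_mul, hb, one_mul])
  unfold majorant wt
  simp only
  rw [hA, mul_comm u b]
  set A := ‖1 - starRingEnd ℂ a * z‖
  set B := ‖1 - b * u‖
  set C := ‖1 - starRingEnd ℂ z * u‖
  set X := 1 - ‖z‖ ^ 2
  set Y := 1 - ‖u‖ ^ 2
  have e1 : C ^ (-((α - 1) / 2)) ≤ 2 ^ ((α - 1) / 2) * X ^ (-((α - 1) / 2)) := by
    calc C ^ (-((α - 1) / 2)) ≤ (X / 2) ^ (-((α - 1) / 2)) :=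
          Real.rpow_le_rpow_of_nonpos (by positivity) hC (by linarith)
      _ = _ := by
          rw [Real.div_rpow hwz.le (by norm_num), Real.rpow_neg (by norm_num : (0:ℝ) ≤ 2)]
          field_simp
  have e2 : B ^ (-(1 / 2) : ℝ) * C ^ (-(α / 2)) ≤ B ^ (-((α + 1) / 2)) + C ^ (-((α + 1) / 2)) := by
    have := rpow_neg_mul_rpow_neg_le hBpos hCpos (a := 1 / 2) (b := α / 2) (by norm_num)
      (by linarith)
    rwa [show (1 : ℝ) / 2 + α / 2 = (α + 1) / 2 by ring] at this
  have hCs : C ^ (-(α - 1 / 2)) = C ^ (-((α - 1) / 2)) * C ^ (-(α / 2)) := by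
    rw [← Real.rpow_add hCpos]; ring_nf
  have hXs : X ^ ((α - 3) / 2) = X ^ (-((α - 1) / 2)) * X ^ (α - 2) := by
    rw [← Real.rpow_add hwz]; ring_nf
  rw [hCs, hXs]
  calc A ^ (-(1 / 2) : ℝ) * B ^ (-(1 / 2) : ℝ) * (C ^ (-((α - 1) / 2)) * C ^ (-(α / 2))) *
        X ^ (α - 2) * Y ^ (α - 2)
      = (C ^ (-((α - 1) / 2)) * (A ^ (-(1 / 2) : ℝ) * X ^ (α - 2))) *
        ((B ^ (-(1 / 2) : ℝ) * C ^ (-(α / 2))) * Y ^ (α - 2)) := by ring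
    _ ≤ ((2 ^ ((α - 1) / 2) * X ^ (-((α - 1) / 2))) * (A ^ (-(1 / 2) : ℝ) * X ^ (α - 2))) *
        ((B ^ (-((α + 1) / 2)) + C ^ (-((α + 1) / 2))) * Y ^ (α - 2)) := by gcongr
    _ = _ := by ring

lemma measurableSet_disk : MeasurableSet Disk := measurableSet_ball

lemma integrableOn_majorant {α : ℝ} (hα : 1 < α) {a b : ℂ} (ha : ‖a‖ = 1) (hb : ‖b‖ = 1) :
    IntegrableOn (majorant α a b) (Disk ×ˢ Disk) := by
  obtain ⟨M, hM, hMle⟩ := exists_lintegral_norm_one_sub_rpow_bound (β := (α + 1) / 2)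
    (γ := α - 2) (by linarith) (by linarith) (by linarith)
  obtain ⟨L, hL, hLle⟩ := exists_lintegral_norm_one_sub_rpow_bound (β := 1 / 2)
    (γ := (α - 3) / 2) (by linarith) (by linarith) (by linarith)
  have hmeas : Measurable (majorant α a b) := by
    have := measurable_wt α
    unfold majorant
    fun_prop
  have hset : MeasurableSet (Disk ×ˢ Disk) := measurableSet_disk.prod measurableSet_disk
  refine ⟨hmeas.aestronglyMeasurable, ?_⟩
  rw [hasFiniteIntegral_iff_ofReal]
  swap
  · filter_upwards [ae_restrict_mem hset] with p hp
    have h1 := wt_pos α hp.1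
    have h2 := wt_pos α hp.2
    simp only [Pi.zero_apply]
    unfold majorant
    positivity
  rw [Measure.volume_eq_prod, setLIntegral_prod _ (by fun_prop)]
  set c : ℝ := 2 ^ ((α - 1) / 2)
  set G : ℂ → ℝ := fun z => ‖1 - starRingEnd ℂ a * z‖ ^ (-(1 / 2) : ℝ) *
    (1 - ‖z‖ ^ 2) ^ ((α - 3) / 2)
  have hGm : Measurable G := by fun_prop
  have hinner : ∀ z ∈ Disk, ∫⁻ u in Disk, ENNReal.ofReal (majorant α a b (z, u)) ≤
      ENNReal.ofReal (c * G z) * (M + M) := by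
    intro z hz
    have hz1 : ‖z‖ < 1 := by simpa [Disk] using hz
    have hwz := one_sub_norm_sq_pos hz
    calc ∫⁻ u in Disk, ENNReal.ofReal (majorant α a b (z, u))
        ≤ ∫⁻ u in Disk, ENNReal.ofReal (c * G z) *
          (ENNReal.ofReal (‖1 - b * u‖ ^ (-((α + 1) / 2)) * (1 - ‖u‖ ^ 2) ^ (α - 2)) +
          ENNReal.ofReal (‖1 - starRingEnd ℂ z * u‖ ^ (-((α + 1) / 2)) *
            (1 - ‖u‖ ^ 2) ^ (α - 2))) := by
          refine setLIntegral_mono' measurableSet_disk fun u hu => ?_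
          have hwu := one_sub_norm_sq_pos hu
          rw [← ENNReal.ofReal_add (by positivity) (by positivity),
            ← ENNReal.ofReal_mul (by positivity)]
          exact ENNReal.ofReal_le_ofReal (majorant_le hα hb hz hu)
      _ ≤ ENNReal.ofReal (c * G z) * (M + M) := by
          rw [lintegral_const_mul _ (by fun_prop), lintegral_add_left (by fun_prop)]
          gcongr
          · exact hMle b hb.le
          · exact hMle _ (by rw [Complex.norm_conj]; exact hz1.le)
  refine lt_of_le_of_lt (setLIntegral_mono' measurableSet_disk hinner) ?_
  rw [lintegral_mul_const _ (by fun_prop)]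
  refine ENNReal.mul_lt_top ?_ (ENNReal.add_lt_top.2 ⟨hM, hM⟩)
  simp_rw [ENNReal.ofReal_mul (show 0 ≤ c by positivity)]
  rw [lintegral_const_mul _ (by fun_prop)]
  exact ENNReal.mul_lt_top ENNReal.ofReal_lt_top
    ((hLle _ (by rw [Complex.norm_conj, ha])).trans_lt hL)

lemma integrableOn_wt_mul_wt {α : ℝ} (hα : 1 < α) :
    IntegrableOn (fun p : ℂ × ℂ => wt α p.1 * wt α p.2) (Disk ×ˢ Disk) := by
  obtain ⟨M, hM, hMle⟩ := exists_lintegral_norm_one_sub_rpow_bound (β := 0)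
    (γ := α - 2) (by linarith) le_rfl (by linarith)
  have h : IntegrableOn (wt α) Disk := by
    refine ⟨(measurable_wt α).aestronglyMeasurable, ?_⟩
    rw [hasFiniteIntegral_iff_ofReal]
    · simpa [wt] using (hMle 0 (by simp)).trans_lt hM
    · filter_upwards [ae_restrict_mem measurableSet_disk] with z hz
      exact (wt_pos α hz).le
  rw [IntegrableOn, Measure.volume_eq_prod, ← Measure.prod_restrict]
  exact h.mul_prod h

/-- Holomorphic dependence of an integral on a parameter under a local integrable bound. -/
lemma differentiableAt_integral_of_norm_le {X : Type*} [MeasurableSpace X] {μ : Measure X}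
    {t₀ : ℂ} {r : ℝ} (hr : 0 < r) {H : ℂ → X → ℂ} {b : X → ℝ}
    (hmeas : ∀ t ∈ ball t₀ r, AEStronglyMeasurable (H t) μ)
    (hb : Integrable b μ)
    (hbound : ∀ᵐ x ∂μ, ∀ t ∈ ball t₀ r, ‖H t x‖ ≤ b x)
    (hdiff : ∀ᵐ x ∂μ, DifferentiableOn ℂ (H · x) (ball t₀ r)) :
    DifferentiableAt ℂ (fun t => ∫ x, H t x ∂μ) t₀ := by
  have hr2 : 0 < r / 2 := by positivity
  have hsub : ∀ t ∈ ball t₀ (r / 2), closedBall t (r / 4) ⊆ ball t₀ r := by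
    intro t ht
    refine closedBall_subset_ball' ?_
    rw [mem_ball] at ht
    linarith
  have ht₀ : t₀ ∈ ball t₀ r := mem_ball_self hr
  refine (hasDerivAt_integral_of_dominated_loc_of_deriv_le (F' := fun t x => deriv (H · x) t)
    (bound := fun x => b x / (r / 4)) (ball_mem_nhds t₀ hr2) ?_ ?_ ?_ ?_ ?_ ?_).2.differentiableAt
  · filter_upwards [ball_mem_nhds t₀ hr] with t ht using hmeas t ht
  · exact hb.mono' (hmeas t₀ ht₀) (hbound.mono fun x hx => hx t₀ ht₀)
  · obtain ⟨e, he⟩ : ∃ e : ℕ → ℂ, e = fun n : ℕ => ((r / 2 / (n + 1) : ℝ) : ℂ) := ⟨_, rfl⟩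
    have hpos : ∀ n : ℕ, 0 < r / 2 / ((n : ℝ) + 1) := fun n => by positivity
    have he_lim : Filter.Tendsto e Filter.atTop (nhds 0) := by
      rw [he]
      have h := tendsto_const_div_atTop_nhds_zero_nat (r / 2)
      have h' := (Filter.tendsto_add_atTop_iff_nat 1).2 h
      have h'' := (Complex.continuous_ofReal.tendsto 0).comp h'
      simpa [Function.comp_def] using h''
    have he_ne : ∀ n, e n ≠ 0 := fun n => by
      rw [he]
      exact Complex.ofReal_ne_zero.2 (hpos n).ne'
    have he_mem : ∀ n, t₀ + e n ∈ ball t₀ r := fun n => by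
      rw [he, mem_ball, dist_eq_norm, add_sub_cancel_left, Complex.norm_real,
        Real.norm_of_nonneg (hpos n).le]
      have : r / 2 / ((n : ℝ) + 1) ≤ r / 2 :=
        div_le_self hr2.le (by linarith [n.cast_nonneg (α := ℝ)])
      linarith
    refine aestronglyMeasurable_of_tendsto_ae Filter.atTop
      (f := fun n x => (e n)⁻¹ • (H (t₀ + e n) x - H t₀ x)) (fun n => ?_) ?_
    · exact ((hmeas _ (he_mem n)).sub (hmeas _ ht₀)).const_smul (e n)⁻¹
    · filter_upwards [hdiff] with x hx
      have hd : HasDerivAt (H · x) (deriv (H · x) t₀) t₀ :=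
        (hx.differentiableAt (ball_mem_nhds t₀ hr)).hasDerivAt
      exact hd.tendsto_slope_zero.comp (tendsto_nhdsWithin_iff.2
        ⟨he_lim, Filter.Eventually.of_forall he_ne⟩)
  · filter_upwards [hbound, hdiff] with x hx hd t ht
    refine Complex.norm_deriv_le_of_forall_mem_sphere_norm_le (by positivity) ?_ ?_
    · refine (hd.mono ?_).diffContOnCl
      rw [closure_ball _ (by positivity)]
      exact hsub t ht
    · exact fun w hw => hx w (hsub t ht (sphere_subset_closedBall hw))
  · exact hb.div_const _
  · filter_upwards [hdiff] with x hx t ht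
    exact (hx.differentiableAt (isOpen_ball.mem_nhds
      (ball_subset_ball (by linarith) ht))).hasDerivAt

/-- The integral over the bidisk against the product weight depends holomorphically on a
parameter as soon as the integrand is jointly continuous up to the closed bidisk. -/
lemma differentiableOn_integral_disk_prod {α : ℝ} (hα : 1 < α) {U : Set ℂ} (hU : IsOpen U)
    {H : ℂ → ℂ × ℂ → ℂ}
    (hcont : ContinuousOn (fun q : ℂ × (ℂ × ℂ) => H q.1 q.2)
      (U ×ˢ (closedBall (0 : ℂ) 1 ×ˢ closedBall (0 : ℂ) 1)))
    (hdiff : ∀ p ∈ Disk ×ˢ Disk, DifferentiableOn ℂ (H · p) U) :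
    DifferentiableOn ℂ
      (fun t => ∫ p in Disk ×ˢ Disk, H t p * (wt α p.1 : ℂ) * (wt α p.2 : ℂ)) U := by
  intro t₀ ht₀
  refine DifferentiableAt.differentiableWithinAt ?_
  obtain ⟨r, hr, hrU⟩ := nhds_basis_closedBall.mem_iff.1 (hU.mem_nhds ht₀)
  have hset : MeasurableSet (Disk ×ˢ Disk) := measurableSet_disk.prod measurableSet_disk
  have hDc : Disk ×ˢ Disk ⊆ closedBall (0 : ℂ) 1 ×ˢ closedBall (0 : ℂ) 1 :=
    prod_mono ball_subset_closedBall ball_subset_closedBall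
  obtain ⟨C, hC⟩ := ((isCompact_closedBall t₀ r).prod
    ((isCompact_closedBall (0 : ℂ) 1).prod
      (isCompact_closedBall (0 : ℂ) 1))).exists_bound_of_continuousOn
    (hcont.mono (prod_mono hrU Subset.rfl))
  have hwt := measurable_wt α
  refine differentiableAt_integral_of_norm_le hr (b := fun p => C * (wt α p.1 * wt α p.2))
    ?_ ((integrableOn_wt_mul_wt hα).const_mul C) ?_ ?_
  · intro t ht
    have htU : t ∈ U := hrU (ball_subset_closedBall ht)
    have hc : ContinuousOn (H t) (Disk ×ˢ Disk) :=
      hcont.comp (f := fun p => (t, p)) (by fun_prop) fun p hp => ⟨htU, hDc hp⟩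
    refine ((hc.aestronglyMeasurable hset).mul ?_).mul ?_
    · exact (Complex.measurable_ofReal.comp (hwt.comp measurable_fst)).aestronglyMeasurable
    · exact (Complex.measurable_ofReal.comp (hwt.comp measurable_snd)).aestronglyMeasurable
  · filter_upwards [ae_restrict_mem hset] with p hp t ht
    have h1 := wt_pos α hp.1
    have h2 := wt_pos α hp.2
    rw [norm_mul, norm_mul, Complex.norm_real, Complex.norm_real, Real.norm_of_nonneg h1.le,
      Real.norm_of_nonneg h2.le, mul_assoc]
    gcongr
    exact hC (t, p) ⟨ball_subset_closedBall ht, hDc hp⟩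
  · filter_upwards [ae_restrict_mem hset] with p hp
    exact (((hdiff p hp).mono (ball_subset_closedBall.trans hrU)).mul_const _).mul_const _

lemma norm_exp_I_mul (φ : ℝ) : ‖Complex.exp (Complex.I * φ)‖ = 1 := by
  rw [mul_comm]; exact Complex.norm_exp_ofReal_mul_I φ

lemma norm_exp_neg_I_mul (φ : ℝ) : ‖Complex.exp (-(Complex.I * φ))‖ = 1 := by
  rw [Complex.exp_neg, norm_inv, norm_exp_I_mul, inv_one]

lemma norm_lt_one_of_mem_disk {z : ℂ} (hz : z ∈ Disk) : ‖z‖ < 1 := by simpa [Disk] using hz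

lemma mem_disk_of_norm_lt_one {z : ℂ} (hz : ‖z‖ < 1) : z ∈ Disk := by simpa [Disk] using hz

lemma norm_conj_mul_exp_lt_one (φ : ℝ) {z : ℂ} (hz : z ∈ Disk) :
    ‖starRingEnd ℂ z * Complex.exp (Complex.I * φ)‖ < 1 := by
  rw [norm_mul, norm_exp_I_mul, mul_one, Complex.norm_conj]
  exact norm_lt_one_of_mem_disk hz

lemma norm_mul_exp_neg_lt_one (φ : ℝ) {u : ℂ} (hu : u ∈ Disk) :
    ‖u * Complex.exp (-(Complex.I * φ))‖ < 1 := by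
  rw [norm_mul, norm_exp_neg_I_mul, mul_one]
  exact norm_lt_one_of_mem_disk hu

lemma norm_conj_mul_lt_one {z u : ℂ} (hz : z ∈ Disk) (hu : u ∈ Disk) :
    ‖starRingEnd ℂ z * u‖ < 1 := by
  rw [norm_mul, Complex.norm_conj]
  have h1 := norm_lt_one_of_mem_disk hz
  have h2 := norm_lt_one_of_mem_disk hu
  nlinarith [norm_nonneg z, norm_nonneg u]

lemma one_sub_mem_slitPlane {w : ℂ} (hw : ‖w‖ < 1) : 1 - w ∈ Complex.slitPlane := by
  rw [sub_eq_add_neg]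
  exact Complex.mem_slitPlane_of_norm_lt_one (by rwa [norm_neg])

lemma continuousOn_Kker (α φ : ℝ) :
    ContinuousOn (fun q : ℂ × ℂ × ℂ => Kker α φ q.1 q.2.1 q.2.2) (univ ×ˢ (Disk ×ˢ Disk)) := by
  have hconj : Continuous (starRingEnd ℂ) := Complex.continuous_conj
  unfold Kker
  refine ((ContinuousOn.cpow ?_ ?_ ?_).mul (ContinuousOn.cpow ?_ ?_ ?_)).mul
    (ContinuousOn.cpow ?_ ?_ ?_)
  any_goals fun_prop
  · exact fun q hq => one_sub_mem_slitPlane (norm_conj_mul_exp_lt_one φ hq.2.1)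
  · exact fun q hq => one_sub_mem_slitPlane (norm_mul_exp_neg_lt_one φ hq.2.2)
  · exact fun q hq => one_sub_mem_slitPlane (norm_conj_mul_lt_one hq.2.1 hq.2.2)

lemma differentiable_Kker (α φ : ℝ) {z u : ℂ} (hz : z ∈ Disk) (hu : u ∈ Disk) :
    Differentiable ℂ fun s => Kker α φ s z u := by
  unfold Kker
  refine ((Differentiable.const_cpow (by fun_prop) (Or.inl ?_)).mul
    (Differentiable.const_cpow (by fun_prop) (Or.inl ?_))).mul
    (Differentiable.const_cpow (by fun_prop) (Or.inl ?_))
  · exact Complex.slitPlane_ne_zero (one_sub_mem_slitPlane (norm_conj_mul_exp_lt_one φ hz))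
  · exact Complex.slitPlane_ne_zero (one_sub_mem_slitPlane (norm_mul_exp_neg_lt_one φ hu))
  · exact Complex.slitPlane_ne_zero (one_sub_mem_slitPlane (norm_conj_mul_lt_one hz hu))

/-- The annulus `1/R < |t| < 1`. -/
def annulus (R : ℝ) : Set ℂ := {t | 1 < R * ‖t‖ ∧ ‖t‖ < 1}

lemma isOpen_annulus (R : ℝ) : IsOpen (annulus R) :=
  (isOpen_lt (continuous_const (y := (1 : ℝ))) (continuous_const.mul continuous_norm)).inter
    (isOpen_lt continuous_norm (continuous_const (y := (1 : ℝ))))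

/-- The integrand of `Jop` with `z̄, u` multiplied by `t` in the kernel and `z, ū` divided by `t`
in the function. -/
def dilated (α φ : ℝ) (g : ℂ → ℂ → ℂ) (s t : ℂ) (p : ℂ × ℂ) : ℂ :=
  Kker α φ s (starRingEnd ℂ t * p.1) (t * p.2) * g (p.1 / t) (starRingEnd ℂ p.2 / t)

/-- The integral of `dilated` against the product weight. -/
def Jdilated (α φ : ℝ) (g : ℂ → ℂ → ℂ) (s t : ℂ) : ℂ :=
  ∫ p in Disk ×ˢ Disk, dilated α φ g s t p * (wt α p.1 : ℂ) * (wt α p.2 : ℂ)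

lemma ne_zero_of_mem_annulus {R : ℝ} {t : ℂ} (ht : t ∈ annulus R) : t ≠ 0 := by
  rintro rfl
  have := ht.1
  simp at this
  linarith

lemma mul_mem_disk {t z : ℂ} (ht : ‖t‖ < 1) (hz : ‖z‖ ≤ 1) : t * z ∈ Disk := by
  refine mem_disk_of_norm_lt_one ?_
  rw [norm_mul]
  nlinarith [norm_nonneg t, norm_nonneg z]

lemma div_mem_ball {R : ℝ} {t z : ℂ} (ht : 1 < R * ‖t‖) (ht0 : t ≠ 0) (hz : ‖z‖ ≤ 1) :
    z / t ∈ ball (0 : ℂ) R := by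
  rw [mem_ball_zero_iff, norm_div, div_lt_iff₀ (norm_pos_iff.2 ht0)]
  linarith

lemma continuousOn_dilated (α φ : ℝ) {R : ℝ} {g : ℂ → ℂ → ℂ}
    (hg : ContinuousOn (fun p : ℂ × ℂ => g p.1 p.2) (ball 0 R ×ˢ ball 0 R)) :
    ContinuousOn (fun q : ℂ × ℂ × (ℂ × ℂ) => dilated α φ g q.1 q.2.1 q.2.2)
      (univ ×ˢ (annulus R ×ˢ (closedBall (0 : ℂ) 1 ×ˢ closedBall (0 : ℂ) 1))) := by
  have hconj : Continuous (starRingEnd ℂ) := Complex.continuous_conj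
  unfold dilated
  refine ContinuousOn.mul ?_ ?_
  · refine (continuousOn_Kker α φ).comp (f := fun q : ℂ × ℂ × (ℂ × ℂ) =>
      (q.1, starRingEnd ℂ q.2.1 * q.2.2.1, q.2.1 * q.2.2.2)) (by fun_prop) ?_
    rintro ⟨s, t, z, u⟩ ⟨-, ht, hz, hu⟩
    simp only [mem_closedBall_zero_iff] at hz hu
    exact ⟨mem_univ _, mul_mem_disk (by simpa using ht.2) hz, mul_mem_disk ht.2 hu⟩
  · refine hg.comp (f := fun q : ℂ × ℂ × (ℂ × ℂ) =>
      (q.2.2.1 / q.2.1, starRingEnd ℂ q.2.2.2 / q.2.1)) ?_ ?_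
    · refine ContinuousOn.prodMk (ContinuousOn.div (by fun_prop) (by fun_prop) ?_)
        (ContinuousOn.div (by fun_prop) (by fun_prop) ?_)
      all_goals exact fun q hq => ne_zero_of_mem_annulus hq.2.1
    · rintro ⟨s, t, z, u⟩ ⟨-, ht, hz, hu⟩
      simp only [mem_closedBall_zero_iff] at hz hu
      have ht0 := ne_zero_of_mem_annulus ht
      exact ⟨div_mem_ball ht.1 ht0 hz, div_mem_ball ht.1 ht0 (by simpa using hu)⟩

lemma differentiableOn_dilated (α φ : ℝ) {R : ℝ} {g : ℂ → ℂ → ℂ}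
    (hg : DifferentiableOn ℂ (fun p : ℂ × ℂ => g p.1 p.2) (ball 0 R ×ˢ ball 0 R)) (s : ℂ)
    {p : ℂ × ℂ} (hp : p ∈ Disk ×ˢ Disk) :
    DifferentiableOn ℂ (fun t => dilated α φ g s t p) (annulus R) := by
  have hz := (norm_lt_one_of_mem_disk hp.1).le
  have hu := (norm_lt_one_of_mem_disk hp.2).le
  have hmz : ∀ t ∈ annulus R, starRingEnd ℂ t * p.1 ∈ Disk :=
    fun t ht => mul_mem_disk (by simpa using ht.2) hz
  have hmu : ∀ t ∈ annulus R, t * p.2 ∈ Disk := fun t ht => mul_mem_disk ht.2 hu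
  unfold dilated
  refine DifferentiableOn.mul ?_ ?_
  · have h1 := fun t ht => one_sub_mem_slitPlane (norm_conj_mul_exp_lt_one φ (hmz t ht))
    have h2 := fun t ht => one_sub_mem_slitPlane (norm_mul_exp_neg_lt_one φ (hmu t ht))
    have h3 := fun t ht => one_sub_mem_slitPlane (norm_conj_mul_lt_one (hmz t ht) (hmu t ht))
    unfold Kker
    simp only [map_mul, Complex.conj_conj] at h1 h2 h3 ⊢
    refine ((DifferentiableOn.cpow (by fun_prop) (by fun_prop) h1).mul
      (DifferentiableOn.cpow (by fun_prop) (by fun_prop) h2)).mul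
      (DifferentiableOn.cpow (by fun_prop) (by fun_prop) h3)
  · refine hg.comp (f := fun t : ℂ => (p.1 / t, starRingEnd ℂ p.2 / t)) ?_ ?_
    · refine DifferentiableOn.prodMk (DifferentiableOn.div (by fun_prop) (by fun_prop) ?_)
        (DifferentiableOn.div (by fun_prop) (by fun_prop) ?_)
      all_goals exact fun t ht => ne_zero_of_mem_annulus ht
    · intro t ht
      have ht0 := ne_zero_of_mem_annulus ht
      exact ⟨div_mem_ball ht.1 ht0 hz, div_mem_ball ht.1 ht0 (by simpa using hu)⟩

lemma differentiable_Jdilated {α : ℝ} (hα : 1 < α) (φ : ℝ) {R : ℝ} {g : ℂ → ℂ → ℂ}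
    (hg : DifferentiableOn ℂ (fun p : ℂ × ℂ => g p.1 p.2) (ball 0 R ×ˢ ball 0 R)) {t : ℂ}
    (ht : t ∈ annulus R) : Differentiable ℂ fun s => Jdilated α φ g s t := by
  rw [← differentiableOn_univ]
  refine differentiableOn_integral_disk_prod hα isOpen_univ
    (H := fun s p => dilated α φ g s t p) ?_ ?_
  · exact (continuousOn_dilated α φ hg.continuousOn).comp
      (f := fun q : ℂ × (ℂ × ℂ) => (q.1, t, q.2)) (by fun_prop) fun q hq => ⟨hq.1, ht, hq.2⟩
  · intro p hp
    have hz := (norm_lt_one_of_mem_disk hp.1).le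
    have hu := (norm_lt_one_of_mem_disk hp.2).le
    exact ((differentiable_Kker α φ (mul_mem_disk (by simpa using ht.2) hz)
      (mul_mem_disk ht.2 hu)).mul_const _).differentiableOn

lemma differentiableOn_Jdilated {α : ℝ} (hα : 1 < α) (φ : ℝ) {R : ℝ} {g : ℂ → ℂ → ℂ}
    (hg : DifferentiableOn ℂ (fun p : ℂ × ℂ => g p.1 p.2) (ball 0 R ×ˢ ball 0 R)) (s : ℂ) :
    DifferentiableOn ℂ (Jdilated α φ g s) (annulus R) := by
  refine differentiableOn_integral_disk_prod hα (isOpen_annulus R)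
    (H := fun t p => dilated α φ g s t p) ?_ fun p hp => differentiableOn_dilated α φ hg s hp
  exact (continuousOn_dilated α φ hg.continuousOn).comp
    (f := fun q : ℂ × (ℂ × ℂ) => (s, q.1, q.2)) (by fun_prop) fun q hq => ⟨mem_univ _, hq⟩

/-- The dilated integral does not change when the dilation parameter is rotated. -/
lemma Jdilated_rotate (α φ : ℝ) (g : ℂ → ℂ → ℂ) (s t : ℂ) {c : ℂ} (hc : ‖c‖ = 1) :
    Jdilated α φ g s (t * c) = Jdilated α φ g s t := by
  have hc' : ‖starRingEnd ℂ c‖ = 1 := by rwa [Complex.norm_conj]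
  have hcc : starRingEnd ℂ c * c = 1 := by
    rw [mul_comm, Complex.mul_conj, Complex.normSq_eq_norm_sq, hc]
    simp
  have hc0 : c ≠ 0 := by rintro rfl; simp at hc
  have hmp := (measurePreserving_unit_mul hc').prod (measurePreserving_unit_mul hc)
  have hme := (measurableEmbedding_unit_mul hc').prodMap (measurableEmbedding_unit_mul hc)
  have hpre : Prod.map (fun z : ℂ => starRingEnd ℂ c * z) (fun u : ℂ => c * u) ⁻¹' (Disk ×ˢ Disk)
      = Disk ×ˢ Disk := by
    ext p; simp [Disk, hc]
  have key := hmp.setIntegral_preimage_emb hme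
    (fun p => dilated α φ g s t p * (wt α p.1 : ℂ) * (wt α p.2 : ℂ)) (Disk ×ˢ Disk)
  rw [hpre] at key
  unfold Jdilated
  rw [Measure.volume_eq_prod, ← key]
  refine integral_congr_ae (Filter.Eventually.of_forall fun p => ?_)
  have hinv : starRingEnd ℂ c = c⁻¹ := eq_inv_of_mul_eq_one_left hcc
  simp only [dilated, Prod.map_fst, Prod.map_snd, wt, norm_mul, hc, hc', one_mul, map_mul]
  congr 3
  · congr 1 <;> ring
  · rw [hinv]
    congr 1 <;> field_simp

lemma deriv_Jdilated_eq_zero {α : ℝ} (hα : 1 < α) (φ : ℝ) {R : ℝ} {g : ℂ → ℂ → ℂ}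
    (hg : DifferentiableOn ℂ (fun p : ℂ × ℂ => g p.1 p.2) (ball 0 R ×ˢ ball 0 R)) (s : ℂ)
    {t : ℂ} (ht : t ∈ annulus R) : deriv (Jdilated α φ g s) t = 0 := by
  have hd : HasDerivAt (Jdilated α φ g s) (deriv (Jdilated α φ g s) t) t :=
    ((differentiableOn_Jdilated hα φ hg s).differentiableAt
      ((isOpen_annulus R).mem_nhds ht)).hasDerivAt
  have he : HasDerivAt (fun θ : ℝ => t * Complex.exp (θ * Complex.I)) (t * Complex.I) 0 := by
    have h := ((Complex.ofRealCLM.hasDerivAt (x := 0)).mul_const Complex.I).cexp.const_mul t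
    simpa using h
  have h0 : t * Complex.exp ((0 : ℝ) * Complex.I) = t := by simp
  have hcomp := HasDerivAt.comp (0 : ℝ) (h₂ := Jdilated α φ g s) (by rwa [h0]) he
  have hconst : (Jdilated α φ g s ∘ fun θ : ℝ => t * Complex.exp (θ * Complex.I)) =
      fun _ => Jdilated α φ g s t := by
    funext θ
    exact Jdilated_rotate α φ g s t (Complex.norm_exp_ofReal_mul_I θ)
  rw [hconst] at hcomp
  have := hcomp.unique (hasDerivAt_const (0 : ℝ) (Jdilated α φ g s t))
  simpa [ne_zero_of_mem_annulus ht] using this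

lemma ofReal_mem_annulus {R x : ℝ} (hR : 1 < R) (hx : x ∈ Ioo (1 / R) 1) :
    (x : ℂ) ∈ annulus R := by
  have h0 : 0 < R := by linarith
  have hx0 : 0 < x := lt_trans (by positivity) hx.1
  refine ⟨?_, ?_⟩
  · rw [Complex.norm_real, Real.norm_of_nonneg hx0.le, mul_comm]
    exact (div_lt_iff₀ h0).1 hx.1
  · rw [Complex.norm_real, Real.norm_of_nonneg hx0.le]
    exact hx.2

lemma Jdilated_ofReal_eq {α : ℝ} (hα : 1 < α) (φ : ℝ) {R : ℝ} (hR : 1 < R) {g : ℂ → ℂ → ℂ}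
    (hg : DifferentiableOn ℂ (fun p : ℂ × ℂ => g p.1 p.2) (ball 0 R ×ˢ ball 0 R)) (s : ℂ)
    {x y : ℝ} (hx : x ∈ Ioo (1 / R) 1) (hy : y ∈ Ioo (1 / R) 1) :
    Jdilated α φ g s x = Jdilated α φ g s y := by
  have hd : ∀ x ∈ Ioo (1 / R) 1, HasDerivAt (fun x : ℝ => Jdilated α φ g s x) 0 x := by
    intro x hx
    have hmem := ofReal_mem_annulus hR hx
    have h := ((differentiableOn_Jdilated hα φ hg s).differentiableAt
      ((isOpen_annulus R).mem_nhds hmem)).hasDerivAt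
    rw [deriv_Jdilated_eq_zero hα φ hg s hmem] at h
    exact h.comp_ofReal
  exact isOpen_Ioo.is_const_of_deriv_eq_zero isPreconnected_Ioo
    (fun x hx => (hd x hx).differentiableAt.differentiableWithinAt) (fun x hx => (hd x hx).deriv)
    hx hy

lemma norm_one_sub_le_two_mul {w : ℂ} {x : ℝ} (hw : ‖w‖ < 1) (hx : 0 ≤ x) (hx1 : x ≤ 1) :
    ‖1 - w‖ / 2 ≤ ‖1 - x * w‖ := by
  have hxw : ‖(x : ℂ) * w‖ = x * ‖w‖ := by rw [norm_mul, Complex.norm_real, Real.norm_of_nonneg hx]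
  have h1 : 1 - x ≤ ‖1 - x * w‖ := by
    have h := norm_sub_norm_le (1 : ℂ) (x * w)
    rw [norm_one, hxw] at h
    nlinarith
  have h2 : ‖1 - w‖ ≤ ‖1 - x * w‖ + (1 - x) := by
    have h3 : 1 - w = (1 - x * w) - ((1 - x : ℝ) : ℂ) * w := by push_cast; ring
    calc ‖1 - w‖ ≤ ‖1 - x * w‖ + ‖((1 - x : ℝ) : ℂ) * w‖ := by
          conv_lhs => rw [h3]
          exact norm_sub_le _ _
      _ ≤ _ := by
          rw [norm_mul, Complex.norm_real, Real.norm_of_nonneg (by linarith)]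
          nlinarith
  linarith

lemma norm_one_sub_cpow_le {w y : ℂ} {x : ℝ} (hw : ‖w‖ < 1) (hx : 0 ≤ x) (hx1 : x ≤ 1)
    (hy : y.re ≤ 0) :
    ‖(1 - x * w) ^ y‖ ≤ (2 ^ (-y.re) * Real.exp (π * |y.im|)) * ‖1 - w‖ ^ y.re := by
  have hpos := norm_one_sub_pos hw
  have hle := norm_one_sub_le_two_mul hw hx hx1
  calc ‖(1 - x * w) ^ y‖ ≤ ‖1 - x * w‖ ^ y.re / Real.exp (Complex.arg (1 - x * w) * y.im) :=
        Complex.norm_cpow_le _ _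
    _ = ‖1 - x * w‖ ^ y.re * Real.exp (-(Complex.arg (1 - x * w) * y.im)) := by
        rw [Real.exp_neg, div_eq_mul_inv]
    _ ≤ (‖1 - w‖ / 2) ^ y.re * Real.exp (π * |y.im|) := by
        refine mul_le_mul (Real.rpow_le_rpow_of_nonpos (by positivity) hle hy)
          (Real.exp_le_exp.2 ?_) (Real.exp_pos _).le (by positivity)
        refine (neg_le_abs _).trans ?_
        rw [abs_mul]
        gcongr
        exact Complex.abs_arg_le_pi _
    _ = _ := by
        rw [Real.div_rpow hpos.le (by norm_num), Real.rpow_neg (by norm_num : (0:ℝ) ≤ 2)]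
        field_simp

lemma exists_norm_Kker_mul_le {α : ℝ} (hα : 1 < α) (φ s : ℝ) :
    ∃ C : ℝ, 0 ≤ C ∧ ∀ x : ℝ, 0 ≤ x → x ≤ 1 → ∀ z ∈ Disk, ∀ u ∈ Disk,
      ‖Kker α φ s (x * z) (x * u)‖ * wt α z * wt α u ≤
        C * majorant α (Complex.exp (Complex.I * φ)) (Complex.exp (-(Complex.I * φ))) (z, u) := by
  set y : ℂ := -(1/2 : ℂ) - Complex.I * (s : ℂ) with hy
  set v : ℂ := -((α : ℂ) - 1/2 - Complex.I * (s : ℂ)) with hv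
  have hyre : y.re = -(1 / 2) := by simp [hy]
  have hvre : v.re = -(α - 1 / 2) := by simp [hv]
  set c₁ : ℝ := 2 ^ (-y.re) * Real.exp (π * |y.im|)
  set c₂ : ℝ := 2 ^ (-v.re) * Real.exp (π * |v.im|)
  refine ⟨c₁ * c₁ * c₂, by positivity, fun x hx hx1 z hz u hu => ?_⟩
  have hwz := wt_pos α hz
  have hwu := wt_pos α hu
  have e1 := norm_one_sub_cpow_le (norm_conj_mul_exp_lt_one φ hz) hx hx1
    (y := y) (by rw [hyre]; norm_num)
  have e2 := norm_one_sub_cpow_le (norm_mul_exp_neg_lt_one φ hu) hx hx1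
    (y := y) (by rw [hyre]; norm_num)
  have e3 := norm_one_sub_cpow_le (x := x ^ 2) (norm_conj_mul_lt_one hz hu) (by positivity)
    (by nlinarith) (y := v) (by rw [hvre]; linarith)
  have hK : Kker α φ s (x * z) (x * u) =
      (1 - x * (starRingEnd ℂ z * Complex.exp (Complex.I * φ))) ^ y *
      (1 - x * (u * Complex.exp (-(Complex.I * φ)))) ^ y *
      (1 - (x ^ 2 : ℝ) * (starRingEnd ℂ z * u)) ^ v := by
    simp only [Kker, hy, hv, map_mul, Complex.conj_ofReal]
    congr 3
    · ring
    · ring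
    · push_cast; ring
  rw [hK, norm_mul, norm_mul, majorant, ← hyre, ← hvre]
  simp only
  set P := ‖1 - starRingEnd ℂ z * Complex.exp (Complex.I * φ)‖ ^ y.re
  set Q := ‖1 - u * Complex.exp (-(Complex.I * φ))‖ ^ y.re
  set S := ‖1 - starRingEnd ℂ z * u‖ ^ v.re
  calc _ ≤ (c₁ * P) * (c₁ * Q) * (c₂ * S) * wt α z * wt α u := by gcongr
    _ = _ := by ring

/-- For real `s` the dilated integrals converge to the undilated one. -/
lemma tendsto_Jdilated {α : ℝ} (hα : 1 < α) (φ : ℝ) {R : ℝ} (hR : 1 < R) {g : ℂ → ℂ → ℂ}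
    (hg : ContinuousOn (fun p : ℂ × ℂ => g p.1 p.2) (ball 0 R ×ˢ ball 0 R)) (s : ℝ) :
    Filter.Tendsto (fun x : ℝ => Jdilated α φ g s x) (nhdsWithin 1 (Iio 1))
      (nhds (Jop α g φ s)) := by
  obtain ⟨ρ, hρ, hρ1⟩ : ∃ ρ, 1 / R < ρ ∧ ρ < 1 :=
    exists_between (by rw [div_lt_one (by linarith)]; exact hR)
  have hR0 : 0 < R := by linarith
  have hρ0 : 0 < ρ := lt_trans (by positivity) hρ
  have hρR : ρ⁻¹ < R := by
    rw [inv_lt_comm₀ hρ0 hR0, ← one_div]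
    exact hρ
  obtain ⟨C, hC0, hC⟩ := exists_norm_Kker_mul_le hα φ s
  obtain ⟨B, hB⟩ := ((isCompact_closedBall (0 : ℂ) ρ⁻¹).prod
    (isCompact_closedBall (0 : ℂ) ρ⁻¹)).exists_bound_of_continuousOn
    (hg.mono (prod_mono (closedBall_subset_ball hρR) (closedBall_subset_ball hρR)))
  have hset : MeasurableSet (Disk ×ˢ Disk) := measurableSet_disk.prod measurableSet_disk
  have hDc : Disk ×ˢ Disk ⊆ closedBall (0 : ℂ) 1 ×ˢ closedBall (0 : ℂ) 1 :=
    prod_mono ball_subset_closedBall ball_subset_closedBall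
  have hwt := measurable_wt α
  have hnear : ∀ᶠ x : ℝ in nhdsWithin 1 (Iio 1), x ∈ Ioo ρ 1 := Ioo_mem_nhdsLT hρ1
  have hconj : Continuous (starRingEnd ℂ) := Complex.continuous_conj
  unfold Jdilated Jop
  refine tendsto_integral_filter_of_dominated_convergence
    (fun p => B * (C * majorant α (Complex.exp (Complex.I * φ))
      (Complex.exp (-(Complex.I * φ))) p)) ?_ ?_ ?_ ?_
  · filter_upwards [hnear] with x hx
    have hxA : (x : ℂ) ∈ annulus R := ofReal_mem_annulus hR ⟨hρ.trans hx.1, hx.2⟩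
    have hc : ContinuousOn (dilated α φ g s x) (Disk ×ˢ Disk) :=
      (continuousOn_dilated α φ hg).comp (f := fun p : ℂ × ℂ => ((s : ℂ), (x : ℂ), p))
        (by fun_prop) fun p hp => ⟨mem_univ _, hxA, hDc hp⟩
    refine ((hc.aestronglyMeasurable hset).mul ?_).mul ?_
    · exact (Complex.measurable_ofReal.comp (hwt.comp measurable_fst)).aestronglyMeasurable
    · exact (Complex.measurable_ofReal.comp (hwt.comp measurable_snd)).aestronglyMeasurable
  · filter_upwards [hnear] with x hx
    filter_upwards [ae_restrict_mem hset] with p hp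
    have hx0 : 0 < x := hρ0.trans hx.1
    have hz := norm_lt_one_of_mem_disk hp.1
    have hu := norm_lt_one_of_mem_disk hp.2
    have h1 := wt_pos α hp.1
    have h2 := wt_pos α hp.2
    have hdiv : ∀ w : ℂ, ‖w‖ < 1 → w / x ∈ closedBall (0 : ℂ) ρ⁻¹ := by
      intro w hw
      rw [mem_closedBall_zero_iff, norm_div, Complex.norm_real, Real.norm_of_nonneg hx0.le,
        ← one_div]
      exact div_le_div₀ zero_le_one hw.le hρ0 hx.1.le
    have hgB := hB (p.1 / x, starRingEnd ℂ p.2 / x) ⟨hdiv _ hz, hdiv _ (by simpa using hu)⟩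
    have hB0 : 0 ≤ B := (norm_nonneg _).trans hgB
    have hK := hC x hx0.le hx.2.le p.1 hp.1 p.2 hp.2
    rw [dilated, norm_mul, norm_mul, norm_mul, Complex.norm_real, Complex.norm_real,
      Real.norm_of_nonneg h1.le, Real.norm_of_nonneg h2.le, Complex.conj_ofReal]
    calc _ = ‖g (p.1 / x) (starRingEnd ℂ p.2 / x)‖ *
          (‖Kker α φ s (x * p.1) (x * p.2)‖ * wt α p.1 * wt α p.2) := by ring
      _ ≤ _ := by gcongr
  · exact ((integrableOn_majorant hα (norm_exp_I_mul φ) (norm_exp_neg_I_mul φ)).const_mul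
      C).const_mul B
  · filter_upwards [ae_restrict_mem hset] with p hp
    refine Filter.Tendsto.mul_const _ (Filter.Tendsto.mul_const _ ?_)
    refine Filter.Tendsto.mono_left ?_ nhdsWithin_le_nhds
    have hopen : IsOpen Disk := isOpen_ball
    have hz := norm_lt_one_of_mem_disk hp.1
    have hu := norm_lt_one_of_mem_disk hp.2
    have hKc : ContinuousAt (fun q : ℂ × ℂ × ℂ => Kker α φ q.1 q.2.1 q.2.2) (s, p.1, p.2) :=
      (continuousOn_Kker α φ).continuousAt
        ((isOpen_univ.prod (hopen.prod hopen)).mem_nhds ⟨mem_univ _, hp⟩)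
    have hgc : ContinuousAt (fun p : ℂ × ℂ => g p.1 p.2) (p.1, starRingEnd ℂ p.2) :=
      hg.continuousAt ((isOpen_ball.prod isOpen_ball).mem_nhds
        ⟨by simpa using hz.trans hR, by simpa using hu.trans hR⟩)
    have hm1 : Filter.Tendsto (fun x : ℝ =>
        ((s : ℂ), starRingEnd ℂ (x : ℂ) * p.1, (x : ℂ) * p.2)) (nhds 1)
        (nhds ((s : ℂ), p.1, p.2)) := by
      have hc : Continuous fun x : ℝ =>
        ((s : ℂ), starRingEnd ℂ (x : ℂ) * p.1, (x : ℂ) * p.2) := by fun_prop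
      simpa using hc.tendsto 1
    have hm2 : Filter.Tendsto (fun x : ℝ => (p.1 / (x : ℂ), starRingEnd ℂ p.2 / (x : ℂ)))
        (nhds 1) (nhds (p.1, starRingEnd ℂ p.2)) := by
      have hc : ContinuousAt (fun x : ℝ => (p.1 / (x : ℂ), starRingEnd ℂ p.2 / (x : ℂ))) 1 := by
        refine ContinuousAt.prodMk (ContinuousAt.div (by fun_prop) (by fun_prop) (by simp))
          (ContinuousAt.div (by fun_prop) (by fun_prop) (by simp))
      simpa using hc.tendsto
    exact (hKc.tendsto.comp hm1).mul (hgc.tendsto.comp hm2)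

lemma Jop_congr (α φ : ℝ) {f g : ℂ → ℂ → ℂ}
    (h : ∀ p ∈ Disk ×ˢ Disk, g p.1 p.2 = f p.1 p.2) (s : ℂ) : Jop α g φ s = Jop α f φ s := by
  unfold Jop
  refine setIntegral_congr_fun (measurableSet_disk.prod measurableSet_disk) fun p hp => ?_
  have := h (p.1, starRingEnd ℂ p.2) ⟨hp.1, mem_disk_of_norm_lt_one (by
    simpa using norm_lt_one_of_mem_disk hp.2)⟩
  simp only at this ⊢
  rw [this]

/-- **Lemma.** Fix `φ ∈ [0,2π]`. For `f ∈ W`, the function `s ↦ J_α f(φ,s)`, initially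
defined for real `s`, extends to a holomorphic (entire) function on all of `ℂ`. -/
theorem stmt_2 (α : ℝ) (hα : 1 < α) (f : ℂ → ℂ → ℂ) (hf : MemW α f)
    (φ : ℝ) (hφ : φ ∈ Set.Icc (0:ℝ) (2*π)) :
    ∃ F : ℂ → ℂ, Differentiable ℂ F ∧ ∀ s : ℝ, F (s : ℂ) = Jop α f φ (s : ℂ) := by
  obtain ⟨-, δ, hδ, g, hg, hgf⟩ := hf
  have hR : 1 < 1 + δ := by linarith
  have hlt : 1 / (1 + δ) < 1 := by rw [div_lt_one (by linarith)]; exact hR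
  obtain ⟨ρ, hρ⟩ := exists_between hlt
  refine ⟨fun s => Jdilated α φ g s ρ, differentiable_Jdilated hα φ hg
    (ofReal_mem_annulus hR hρ), fun s => ?_⟩
  rw [← Jop_congr α φ hgf]
  refine tendsto_nhds_unique ?_ (tendsto_Jdilated hα φ hR hg.continuousOn s)
  refine tendsto_const_nhds.congr' ?_
  filter_upwards [Ioo_mem_nhdsLT hlt] with x hx
  exact Jdilated_ofReal_eq hα φ hR hg s hρ hx
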